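/- Let G = (V, E, A) be a symmetric connected graph on V = {1,...,N} and θ : [0,∞) → ℝ^N a three times continuously differentiable solution of m θ_i'' + θ_i' = Ω_i + (K/N) Σ_{l=1}^N a_{il} sin(θ_l − θ_i + α) with ω_i = θ_i'. Suppose Assumption (A) holds: E₁(0) < D₀²/8; D^∞ ∈ (0, π/2), D₀ ∈ (0, π), D^∞ < D₀; sin α < (a_l cos α cos D^∞)/(12 a_u (1+r|E^c|) sin D^∞); m < 1; √K > ((1+r|E^c|)/(a_l cos α)) · max{D₀/sin D₀, 1/cos D^∞}; m√K < 1/8; mK < (a_l/(a_u²(1+r|E^c|) cos α)) · min{sin D₀/(36 D₀), cos D^∞/24}; K sin α < 1/(8 a_u sin D^∞); C₁ < (D^∞)²/16. Then there exist a constant C > 0 and a finite time t_* ≥ 0 such that the frequency diameter satisfies D(ω(t)) = max_{1≤i,j≤N}|ω_i(t) − ω_j(t)| ≤ C e^{−(√K/2)(t − t_*)} for all t ≥ t_*. -/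

import Mathlib

open Finset Real

/-- The bilinear form of pairwise differences. -/
noncomputable def BF {N : ℕ} (u v : Fin N → ℝ) : ℝ := ∑ i, ∑ j, (u i - u j) * (v i - v j)

lemma BF_self_nonneg {N : ℕ} (u : Fin N → ℝ) : 0 ≤ BF u u :=
  Finset.sum_nonneg fun i _ => Finset.sum_nonneg fun j _ => mul_self_nonneg _

lemma BF_add {N : ℕ} (u v w : Fin N → ℝ) : BF u (fun i => v i + w i) = BF u v + BF u w := by
  unfold BF
  rw [← Finset.sum_add_distrib]
  refine Finset.sum_congr rfl fun i _ => ?_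
  rw [← Finset.sum_add_distrib]
  exact Finset.sum_congr rfl fun j _ => by ring

lemma BF_young {N : ℕ} (u v : Fin N → ℝ) (e : ℝ) (he : 0 < e) :
    2 * BF u v ≤ e * BF u u + BF v v / e := by
  unfold BF
  rw [Finset.mul_sum, Finset.mul_sum, Finset.sum_div, ← Finset.sum_add_distrib]
  refine Finset.sum_le_sum fun i _ => ?_
  rw [Finset.mul_sum, Finset.mul_sum, Finset.sum_div, ← Finset.sum_add_distrib]
  refine Finset.sum_le_sum fun j _ => ?_
  have h : 0 ≤ (e * (u i - u j) - (v i - v j)) ^ 2 / e := by positivity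
  have h2 : (e * (u i - u j) - (v i - v j)) ^ 2 / e
      = e * ((u i - u j) * (u i - u j)) + (v i - v j) * (v i - v j) / e
        - 2 * ((u i - u j) * (v i - v j)) := by
    field_simp; ring
  linarith

lemma BF_pair {N : ℕ} (u : Fin N → ℝ) (i j : Fin N) : (u i - u j) ^ 2 ≤ BF u u := by
  unfold BF
  have h1 := Finset.single_le_sum (f := fun j => (u i - u j) * (u i - u j))
    (fun j _ => mul_self_nonneg _) (Finset.mem_univ j)
  have h2 := Finset.single_le_sum (f := fun i => ∑ j, (u i - u j) * (u i - u j))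
    (fun i _ => Finset.sum_nonneg fun j _ => mul_self_nonneg _) (Finset.mem_univ i)
  calc (u i - u j) ^ 2 = (u i - u j) * (u i - u j) := by ring
    _ ≤ _ := h1
    _ ≤ _ := h2

lemma BF_expand {N : ℕ} (u v : Fin N → ℝ) :
    BF u v = 2 * N * ∑ i, u i * v i - 2 * (∑ i, u i) * ∑ i, v i := by
  have h1 : ∀ i, ∑ j, (u i - u j) * (v i - v j)
      = N * (u i * v i) + ∑ j, u j * v j - u i * ∑ j, v j - v i * ∑ j, u j := by
    intro i
    have h2 : ∀ j, (u i - u j) * (v i - v j) = u i * v i + u j * v j - u i * v j - v i * u j :=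
      fun j => by ring
    simp only [h2, Finset.sum_sub_distrib, Finset.sum_add_distrib, Finset.mul_sum,
      Finset.sum_const, Finset.card_univ, Fintype.card_fin, nsmul_eq_mul]
  unfold BF
  simp only [h1, Finset.sum_sub_distrib, Finset.sum_add_distrib, ← Finset.mul_sum,
    ← Finset.sum_mul, Finset.sum_const, Finset.card_univ, Fintype.card_fin, nsmul_eq_mul]
  ring

/-- antisymmetric coupling -/
lemma BF_antisymm {N : ℕ} (hN : 0 < N) (p : Fin N → ℝ) (g : Fin N → Fin N → ℝ) (k : ℝ)
    (hg : ∀ i l, g i l = - g l i) :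
    BF p (fun i => k / N * ∑ l, g i l) = -(k * ∑ i, ∑ l, (p l - p i) * g i l) := by
  have hN' : (N : ℝ) ≠ 0 := by positivity
  have h0 : ∑ i, ∑ l, g i l = 0 := by
    have h1 : ∑ i, ∑ l, g i l = ∑ i, ∑ l, g l i := Finset.sum_comm
    have h2 : ∑ i, ∑ l, g i l = - ∑ i, ∑ l, g l i := by
      rw [← Finset.sum_neg_distrib]
      refine Finset.sum_congr rfl fun i _ => ?_
      rw [← Finset.sum_neg_distrib]
      exact Finset.sum_congr rfl fun l _ => hg i l
    linarith
  have h3 : ∑ i, ∑ l, p l * g i l = - ∑ i, ∑ l, p i * g i l := by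
    rw [Finset.sum_comm, ← Finset.sum_neg_distrib]
    refine Finset.sum_congr rfl fun i _ => ?_
    rw [← Finset.sum_neg_distrib]
    exact Finset.sum_congr rfl fun l _ => by rw [hg]; ring
  have h4 : ∑ i, ∑ l, (p l - p i) * g i l = - 2 * ∑ i, ∑ l, p i * g i l := by
    simp only [sub_mul, Finset.sum_sub_distrib]
    rw [h3]; ring
  have h5 : ∑ i, p i * (k / N * ∑ l, g i l) = k / N * ∑ i, ∑ l, p i * g i l := by
    rw [Finset.mul_sum]
    refine Finset.sum_congr rfl fun i _ => ?_
    rw [← Finset.mul_sum]; ring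
  rw [BF_expand, h4, h5, ← Finset.mul_sum, h0]
  field_simp
  ring

lemma BF_coupling_sq {N : ℕ} (hN : 0 < N) (p : Fin N → ℝ) (g : Fin N → Fin N → ℝ) (k γ : ℝ)
    (hg : ∀ i l, (g i l) ^ 2 ≤ γ ^ 2 * (p l - p i) ^ 2) :
    BF (fun i => k / N * ∑ l, g i l) (fun i => k / N * ∑ l, g i l)
      ≤ 2 * (k ^ 2 * γ ^ 2) * BF p p := by
  have hN' : (0 : ℝ) < N := by positivity
  have hs : ∀ i, (k / N * ∑ l, g i l) * (k / N * ∑ l, g i l)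
      ≤ k ^ 2 * γ ^ 2 / N * ∑ l, (p i - p l) * (p i - p l) := by
    intro i
    have h1 : (∑ l, g i l) ^ 2 ≤ N * ∑ l, g i l ^ 2 := by
      have := sq_sum_le_card_mul_sum_sq (s := (Finset.univ : Finset (Fin N))) (f := g i)
      simpa using this
    have h2 : ∑ l, g i l ^ 2 ≤ γ ^ 2 * ∑ l, (p i - p l) * (p i - p l) := by
      rw [Finset.mul_sum]
      refine Finset.sum_le_sum fun l _ => (hg i l).trans (le_of_eq (by ring))
    calc (k / N * ∑ l, g i l) * (k / N * ∑ l, g i l) = k ^ 2 / N ^ 2 * (∑ l, g i l) ^ 2 := by ring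
      _ ≤ k ^ 2 / N ^ 2 * (N * (γ ^ 2 * ∑ l, (p i - p l) * (p i - p l))) := by
          gcongr
          exact h1.trans (by gcongr)
      _ = _ := by field_simp
  rw [BF_expand]
  have h3 : ∑ i, (k / N * ∑ l, g i l) * (k / N * ∑ l, g i l) ≤ k ^ 2 * γ ^ 2 / N * BF p p := by
    unfold BF
    rw [Finset.mul_sum]
    exact Finset.sum_le_sum fun i _ => hs i
  have h4 : 2 * N * ∑ i, (k / N * ∑ l, g i l) * (k / N * ∑ l, g i l)
      ≤ 2 * N * (k ^ 2 * γ ^ 2 / N * BF p p) := by gcongr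
  have h5 : 2 * (N : ℝ) * (k ^ 2 * γ ^ 2 / N * BF p p) = 2 * (k ^ 2 * γ ^ 2) * BF p p := by
    field_simp
  nlinarith [sq_nonneg (∑ i, k / N * ∑ l, g i l)]

lemma BF_bounded_sq {N : ℕ} (hN : 0 < N) (c : Fin N → Fin N → ℝ) (k γ : ℝ) (hk : 0 ≤ k)
    (hc : ∀ i l, |c i l| ≤ γ) :
    BF (fun i => k / N * ∑ l, c i l) (fun i => k / N * ∑ l, c i l)
      ≤ 4 * N ^ 2 * (k ^ 2 * γ ^ 2) := by
  have hN' : (0 : ℝ) < N := by positivity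
  have hs : ∀ i, |k / N * ∑ l, c i l| ≤ k * γ := by
    intro i
    rw [abs_mul, abs_of_nonneg (by positivity : 0 ≤ k / N)]
    have : |∑ l, c i l| ≤ N * γ := by
      refine (Finset.abs_sum_le_sum_abs _ _).trans ?_
      refine (Finset.sum_le_sum fun l _ => hc i l).trans ?_
      simp
    calc k / N * |∑ l, c i l| ≤ k / N * (N * γ) := by gcongr
      _ = _ := by field_simp
  unfold BF
  have : ∀ i j : Fin N, (k / N * ∑ l, c i l - k / N * ∑ l, c j l)
      * (k / N * ∑ l, c i l - k / N * ∑ l, c j l) ≤ 4 * (k ^ 2 * γ ^ 2) := by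
    intro i j
    have h1 := abs_le.1 (hs i)
    have h2 := abs_le.1 (hs j)
    nlinarith
  calc _ ≤ ∑ i : Fin N, ∑ j : Fin N, 4 * (k ^ 2 * γ ^ 2) :=
        Finset.sum_le_sum fun i _ => Finset.sum_le_sum fun j _ => this i j
    _ = _ := by simp; ring

/-- telescoping along a walk -/
lemma walk_telescope {V : Type*} {G : SimpleGraph V} (p : V → ℝ) {u v : V} (w : G.Walk u v) :
    (w.darts.map (fun d => p d.snd - p d.fst)).sum = p v - p u := by
  induction w with
  | nil => simp
  | cons h w ih => simp [ih]

lemma graph_pair {N : ℕ} (a : Fin N → Fin N → ℝ) (G : SimpleGraph (Fin N))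
    (hadj : ∀ i j, G.Adj i j ↔ i ≠ j ∧ 0 < a i j) (hconn : G.Connected)
    (p : Fin N → ℝ) (i j : Fin N) :
    (p i - p j) ^ 2 ≤ G.dist i j *
      ∑ q ∈ Finset.filter (fun q : Fin N × Fin N => 0 < a q.1 q.2) Finset.univ,
        (p q.2 - p q.1) ^ 2 := by
  classical
  obtain ⟨w, hw, hl⟩ := hconn.exists_path_of_dist i j
  have hnd : w.darts.Nodup := List.Nodup.of_map _ hw.isTrail.edges_nodup
  have ht := walk_telescope p w
  rw [← List.sum_toFinset _ hnd] at ht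
  have hcard : (w.darts.toFinset.card : ℝ) = G.dist i j := by
    rw [List.toFinset_card_of_nodup hnd, SimpleGraph.Walk.length_darts, hl]
  have h1 := sq_sum_le_card_mul_sum_sq (s := w.darts.toFinset) (f := fun d => p d.snd - p d.fst)
  rw [ht, hcard] at h1
  have h2 : ∑ d ∈ w.darts.toFinset, (p d.snd - p d.fst) ^ 2 ≤
      ∑ q ∈ Finset.filter (fun q : Fin N × Fin N => 0 < a q.1 q.2) Finset.univ,
        (p q.2 - p q.1) ^ 2 := by
    have hinj : Set.InjOn (fun d : G.Dart => d.toProd) (w.darts.toFinset : Set G.Dart) :=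
      fun x _ y _ h => SimpleGraph.Dart.toProd_injective h
    rw [← Finset.sum_image (f := fun q : Fin N × Fin N => (p q.2 - p q.1) ^ 2) hinj]
    refine Finset.sum_le_sum_of_subset_of_nonneg ?_ (fun _ _ _ => sq_nonneg _)
    intro q hq
    obtain ⟨d, -, rfl⟩ := Finset.mem_image.1 hq
    simp only [Finset.mem_filter, Finset.mem_univ, true_and]
    exact ((hadj _ _).1 d.adj).2
  calc (p i - p j) ^ 2 = (p j - p i) ^ 2 := by ring
    _ ≤ _ := h1
    _ ≤ _ := by gcongr

lemma graph_coercive {N : ℕ} (a : Fin N → Fin N → ℝ) (G : SimpleGraph (Fin N))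
    (hadj : ∀ i j, G.Adj i j ↔ i ≠ j ∧ 0 < a i j) (hconn : G.Connected)
    (r : ℕ) (hr : r = Finset.univ.sup (fun p : Fin N × Fin N => G.dist p.1 p.2))
    (Ec : ℕ) (hEc : Ec = (Finset.filter
      (fun p : Fin N × Fin N => ¬ 0 < a p.1 p.2) Finset.univ).card) (p : Fin N → ℝ) :
    BF p p ≤ (1 + (r : ℝ) * Ec) *
      ∑ q ∈ Finset.filter (fun q : Fin N × Fin N => 0 < a q.1 q.2) Finset.univ,
        (p q.2 - p q.1) ^ 2 := by
  set T := ∑ q ∈ Finset.filter (fun q : Fin N × Fin N => 0 < a q.1 q.2) Finset.univ,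
        (p q.2 - p q.1) ^ 2 with hT
  have hT0 : 0 ≤ T := Finset.sum_nonneg fun _ _ => sq_nonneg _
  have h1 : BF p p = ∑ q : Fin N × Fin N, (p q.2 - p q.1) ^ 2 := by
    rw [Fintype.sum_prod_type]
    exact Finset.sum_congr rfl fun i _ => Finset.sum_congr rfl fun j _ => by ring
  rw [h1, ← Finset.sum_filter_add_sum_filter_not _ (fun q : Fin N × Fin N => 0 < a q.1 q.2), ← hT]
  have h2 : ∑ q ∈ Finset.filter (fun q : Fin N × Fin N => ¬ 0 < a q.1 q.2) Finset.univ,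
        (p q.2 - p q.1) ^ 2 ≤ Ec * (r * T) := by
    rw [hEc, ← nsmul_eq_mul]
    refine Finset.sum_le_card_nsmul _ _ _ fun q _ => ?_
    refine (graph_pair a G hadj hconn p q.2 q.1).trans ?_
    have : G.dist q.2 q.1 ≤ r := by
      rw [hr]
      exact Finset.le_sup (f := fun p : Fin N × Fin N => G.dist p.1 p.2) (Finset.mem_univ (q.2, q.1))
    gcongr
  nlinarith

lemma coupling_coercive {N : ℕ} (hN : 0 < N) (a : Fin N → Fin N → ℝ) (G : SimpleGraph (Fin N))
    (hadj : ∀ i j, G.Adj i j ↔ i ≠ j ∧ 0 < a i j) (hconn : G.Connected)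
    (r : ℕ) (hr : r = Finset.univ.sup (fun p : Fin N × Fin N => G.dist p.1 p.2))
    (Ec : ℕ) (hEc : Ec = (Finset.filter
      (fun p : Fin N × Fin N => ¬ 0 < a p.1 p.2) Finset.univ).card) (p : Fin N → ℝ)
    (g : Fin N → Fin N → ℝ) (k c : ℝ) (hk : 0 ≤ k) (hc : 0 ≤ c)
    (hg : ∀ i l, g i l = - g l i) (hg0 : ∀ i l, 0 ≤ (p l - p i) * g i l)
    (hgc : ∀ i l, 0 < a i l → c * (p l - p i) ^ 2 ≤ (p l - p i) * g i l) :
    BF p (fun i => k / N * ∑ l, g i l) ≤ -(k * c / (1 + (r : ℝ) * Ec) * BF p p) := by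
  rw [BF_antisymm hN p g k hg]
  have h1 := graph_coercive a G hadj hconn r hr Ec hEc p
  set T := ∑ q ∈ Finset.filter (fun q : Fin N × Fin N => 0 < a q.1 q.2) Finset.univ,
        (p q.2 - p q.1) ^ 2 with hT
  have h2 : c * T ≤ ∑ i, ∑ l, (p l - p i) * g i l := by
    rw [← Fintype.sum_prod_type (f := fun q : Fin N × Fin N => (p q.2 - p q.1) * g q.1 q.2), hT,
      Finset.mul_sum]
    calc _ ≤ ∑ q ∈ Finset.filter (fun q : Fin N × Fin N => 0 < a q.1 q.2) Finset.univ,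
        (p q.2 - p q.1) * g q.1 q.2 := by
          refine Finset.sum_le_sum fun q hq => hgc _ _ (Finset.mem_filter.1 hq).2
      _ ≤ _ := Finset.sum_le_sum_of_subset_of_nonneg (Finset.filter_subset _ _)
          fun q _ _ => hg0 _ _
  have hL : (0 : ℝ) < 1 + (r : ℝ) * Ec := by positivity
  have h3 : k * c / (1 + (r : ℝ) * Ec) * BF p p ≤ k * c * T := by
    calc _ ≤ k * c / (1 + (r : ℝ) * Ec) * ((1 + (r : ℝ) * Ec) * T) := by gcongr
      _ = _ := by field_simp
  nlinarith [mul_le_mul_of_nonneg_left h2 hk]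

/-- the energy functional -/
noncomputable def EN {N : ℕ} (m s : ℝ) (p q : Fin N → ℝ) : ℝ :=
  2 * m * BF p q + (1 - m * s) * BF p p + 2 * m ^ 2 * BF q q

lemma EN_lower {N : ℕ} (m s : ℝ) (p q : Fin N → ℝ) (hm : 0 < m) (hms : m * s < 1 / 8) :
    3 / 8 * BF p p ≤ EN m s p q := by
  have h1 : 0 ≤ ∑ i, ∑ j, ((p i - p j) + 2 * m * (q i - q j)) ^ 2 / 2 :=
    Finset.sum_nonneg fun i _ => Finset.sum_nonneg fun j _ => by positivity
  have h2 : ∑ i, ∑ j, ((p i - p j) + 2 * m * (q i - q j)) ^ 2 / 2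
      = 1 / 2 * BF p p + 2 * m * BF p q + 2 * m ^ 2 * BF q q := by
    unfold BF
    simp only [Finset.mul_sum, ← Finset.sum_add_distrib]
    exact Finset.sum_congr rfl fun i _ => Finset.sum_congr rfl fun j _ => by ring
  unfold EN
  nlinarith [BF_self_nonneg p]

lemma BF_hasDeriv {N : ℕ} (p q : ℝ → Fin N → ℝ) (p' q' : Fin N → ℝ) (t : ℝ)
    (hp : ∀ i, HasDerivAt (fun t => p t i) (p' i) t)
    (hq : ∀ i, HasDerivAt (fun t => q t i) (q' i) t) :
    HasDerivAt (fun t => BF (p t) (q t)) (BF p' (q t) + BF (p t) q') t := by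
  unfold BF
  rw [← Finset.sum_add_distrib]
  refine HasDerivAt.fun_sum fun i _ => ?_
  rw [← Finset.sum_add_distrib]
  refine HasDerivAt.fun_sum fun j _ => ?_
  exact ((hp i).sub (hp j)).mul ((hq i).sub (hq j))

lemma BF_comm {N : ℕ} (u v : Fin N → ℝ) : BF u v = BF v u := by
  unfold BF
  exact Finset.sum_congr rfl fun i _ => Finset.sum_congr rfl fun j _ => by ring

lemma EN_hasDeriv {N : ℕ} (m s : ℝ) (p q : ℝ → Fin N → ℝ) (q' F : Fin N → ℝ) (t : ℝ)
    (hp : ∀ i, HasDerivAt (fun t => p t i) (q t i) t)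
    (hq : ∀ i, HasDerivAt (fun t => q t i) (q' i) t)
    (hF : ∀ i, m * q' i + q t i = F i) :
    HasDerivAt (fun t => EN m s (p t) (q t))
      (-(s * EN m s (p t) (q t)) - 2 * m * (1 - m * s) * BF (q t) (q t)
        + s * (1 - m * s) * BF (p t) (p t) + 2 * BF (p t) F + 4 * m * BF (q t) F) t := by
  have h1 := BF_hasDeriv p q _ _ t hp hq
  have h2 := BF_hasDeriv p p _ _ t hp hp
  have h3 := BF_hasDeriv q q _ _ t hq hq
  have hf : ∀ u : Fin N → ℝ, BF u F = m * BF u q' + BF u (q t) := by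
    intro u
    unfold BF
    simp only [Finset.mul_sum, ← Finset.sum_add_distrib]
    exact Finset.sum_congr rfl fun i _ => Finset.sum_congr rfl fun j _ => by
      rw [← hF, ← hF]; ring
  refine (((h1.const_mul (2 * m)).add (h2.const_mul (1 - m * s))).add
    (h3.const_mul (2 * m ^ 2))).congr_deriv ?_
  rw [hf, hf, BF_comm q' (q t), BF_comm (q t) (p t)]
  unfold EN
  ring

lemma sin_mul_ge (D x : ℝ) (hD : 0 < D ∧ D < π) (hx : |x| ≤ D) :
    sin D / D * x ^ 2 ≤ x * sin x := by
  have key : ∀ y, 0 ≤ y → y ≤ D → sin D / D * y ^ 2 ≤ y * sin y := by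
    intro y hy hyD
    have hc := strictConcaveOn_sin_Icc.concaveOn.2
      (show (0 : ℝ) ∈ Set.Icc 0 π from ⟨le_rfl, pi_pos.le⟩)
      (show D ∈ Set.Icc 0 π from ⟨hD.1.le, hD.2.le⟩)
      (show 0 ≤ 1 - y / D by rw [sub_nonneg, div_le_one hD.1]; exact hyD) (div_nonneg hy hD.1.le) (sub_add_cancel _ _)
    have h0 : y / D * D = y := by field_simp [hD.1.ne']
    simp only [sin_zero, smul_eq_mul, mul_zero, zero_add, h0] at hc
    calc _ = y * (y / D * sin D) := by ring
      _ ≤ _ := by gcongr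
  rcases abs_cases x with ⟨h, h'⟩ | ⟨h, h'⟩
  · exact key x h' (h ▸ hx)
  · have := key (-x) (by linarith) (h ▸ hx)
    rw [sin_neg] at this
    nlinarith

lemma phase1_scalar (m s κ X Z PO PS PC QO QS QC DO BC BS β : ℝ) (hm : 0 < m) (hs : 0 < s)
    (hκ : s ≤ κ) (hms : m * s < 1 / 8) (hX : 0 ≤ X) (hZ : 0 ≤ Z)
    (hPS : PS ≤ -(κ * X))
    (hPO : 2 * PO ≤ κ / 3 * X + DO / (κ / 3)) (hPC : 2 * PC ≤ κ / 3 * X + BC / (κ / 3))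
    (hQO : 2 * QO ≤ 1 / 6 * Z + DO / (1 / 6)) (hQC : 2 * QC ≤ 1 / 6 * Z + BC / (1 / 6))
    (hQS : 2 * QS ≤ 1 / 2 * Z + BS / (1 / 2)) (hBS : BS ≤ 2 * β * X) (hβ : m * β ≤ κ / 36) :
    - 2 * m * (1 - m * s) * Z + s * (1 - m * s) * X + 2 * (PO + PS + PC)
      + 4 * m * (QO + QS + QC) ≤ 3 / κ * DO + 12 * m * DO + (3 / κ * BC + 12 * m * BC) := by
  have hκ0 : 0 < κ := by linarith
  have e1 : DO / (κ / 3) = 3 / κ * DO := by field_simp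
  have e2 : BC / (κ / 3) = 3 / κ * BC := by field_simp
  rw [e1] at hPO
  rw [e2] at hPC
  have f1 : 2 * m * (2 * QO) ≤ 2 * m * (1 / 6 * Z + DO / (1 / 6)) := by gcongr
  have f2 : 2 * m * (2 * QC) ≤ 2 * m * (1 / 6 * Z + BC / (1 / 6)) := by gcongr
  have f3 : 2 * m * (2 * QS) ≤ 2 * m * (1 / 2 * Z + (2 * β * X) / (1 / 2)) := by
    have : BS / (1 / 2) ≤ (2 * β * X) / (1 / 2) := by gcongr
    have h2 : 2 * QS ≤ 1 / 2 * Z + (2 * β * X) / (1 / 2) := by linarith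
    gcongr
  have f4 : m * β * X ≤ κ / 36 * X := by gcongr
  have f5 : s * (1 - m * s) * X ≤ κ * X := by
    have : s * (1 - m * s) ≤ κ := by nlinarith [mul_pos hm hs]
    gcongr
  have f6 : 0 ≤ m * Z * (1 / 8 - m * s) :=
    mul_nonneg (mul_nonneg hm.le hZ) (by linarith)
  have f7 : 0 ≤ m * Z := mul_nonneg hm.le hZ
  have f8 : 0 ≤ κ * X := mul_nonneg hκ0.le hX
  nlinarith

lemma phase2_scalar (m s κ Z U PP PQ QP QQ BP BQ β b : ℝ) (hm : 0 < m) (hm1 : m < 1) (hs : 0 < s)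
    (hκ : s ≤ κ) (hms : m * s < 1 / 8) (hZ : 0 ≤ Z) (hU : 0 ≤ U)
    (hPP : PP ≤ -(κ * Z)) (hPQ : 2 * PQ ≤ κ / 6 * Z + BQ / (κ / 6))
    (hQP : 2 * QP ≤ 1 / 2 * U + BP / (1 / 2)) (hQQ : 2 * QQ ≤ 3 / 8 * U + BQ / (3 / 8))
    (hBP : BP ≤ 2 * β * Z) (hβ : m * β ≤ κ / 24)
    (hBQ : BQ ≤ 2 * b ^ 2 * Z) (hb0 : 0 ≤ b) (hb1 : b ≤ κ / 12) (hb2 : b ≤ 1 / 8) :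
    - 2 * m * (1 - m * s) * U + s * (1 - m * s) * Z + 2 * (PP + PQ)
      + 4 * m * (QP + QQ) ≤ 0 := by
  have hκ0 : 0 < κ := by linarith
  have e1 : BQ / (κ / 6) ≤ κ / 12 * Z := by
    rw [div_le_iff₀ (by positivity)]
    have : b ^ 2 ≤ (κ / 12) ^ 2 := by gcongr
    have h2 : 2 * b ^ 2 * Z ≤ 2 * (κ / 12) ^ 2 * Z := by gcongr
    nlinarith
  have f1 : 2 * m * (2 * QP) ≤ 2 * m * (1 / 2 * U + (2 * β * Z) / (1 / 2)) := by
    have : BP / (1 / 2) ≤ (2 * β * Z) / (1 / 2) := by gcongr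
    have h2 : 2 * QP ≤ 1 / 2 * U + (2 * β * Z) / (1 / 2) := by linarith
    gcongr
  have g1 : b ^ 2 ≤ κ / 96 := by nlinarith
  have g2 : BQ / (3 / 8) ≤ (2 * (κ / 96) * Z) / (3 / 8) := by
    have : 2 * b ^ 2 * Z ≤ 2 * (κ / 96) * Z := by gcongr
    have h2 : BQ ≤ 2 * (κ / 96) * Z := by linarith
    gcongr
  have f2 : 2 * m * (2 * QQ) ≤ 2 * m * (3 / 8 * U + (2 * (κ / 96) * Z) / (3 / 8)) := by
    have h2 : 2 * QQ ≤ 3 / 8 * U + (2 * (κ / 96) * Z) / (3 / 8) := by linarith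
    gcongr
  have f4 : m * β * Z ≤ κ / 24 * Z := by gcongr
  have f5 : s * (1 - m * s) * Z ≤ κ * Z := by
    have : s * (1 - m * s) ≤ κ := by nlinarith [mul_pos hm hs]
    gcongr
  have f6 : 0 ≤ m * U * (1 / 8 - m * s) :=
    mul_nonneg (mul_nonneg hm.le hU) (by linarith)
  have f7 : 0 ≤ m * U := mul_nonneg hm.le hU
  have f8 : 0 ≤ κ * Z := mul_nonneg hκ0.le hZ
  have f9 : m * (κ * Z) ≤ 1 * (κ * Z) := by gcongr
  nlinarith

/-- Gronwall. -/
lemma gron (f f' : ℝ → ℝ) (s c t0 : ℝ)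
    (hf : ∀ t ≥ t0, HasDerivAt f (f' t) t) (hle : ∀ t ≥ t0, f' t ≤ s * (c - f t)) :
    ∀ t ≥ t0, f t ≤ c + (f t0 - c) * exp (-s * (t - t0)) := by
  have hd : ∀ t ≥ t0, HasDerivAt (fun t => (f t - c) * exp (s * (t - t0)))
      (f' t * exp (s * (t - t0)) + (f t - c) * (exp (s * (t - t0)) * s)) t := by
    intro t ht
    have h1 : HasDerivAt (fun t => s * (t - t0)) s t := by
      simpa using ((hasDerivAt_id t).sub_const t0).const_mul s
    exact ((hf t ht).sub_const c).mul h1.exp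
  have hanti : AntitoneOn (fun t => (f t - c) * exp (s * (t - t0))) (Set.Ici t0) := by
    apply antitoneOn_of_deriv_nonpos (convex_Ici t0)
    · exact fun t ht => (hd t ht).continuousAt.continuousWithinAt
    · intro t ht
      rw [interior_Ici] at ht
      exact (hd t (le_of_lt ht)).differentiableAt.differentiableWithinAt
    · intro t ht
      rw [interior_Ici] at ht
      rw [(hd t (le_of_lt ht)).deriv]
      have h1 := hle t (le_of_lt ht)
      have h2 := exp_pos (s * (t - t0))
      nlinarith
  intro t ht
  have h := hanti (Set.mem_Ici.2 le_rfl) (Set.mem_Ici.2 ht) ht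
  simp only [sub_self, mul_zero, exp_zero, mul_one] at h
  have h3 : exp (s * (t - t0)) * exp (-s * (t - t0)) = 1 := by
    rw [← exp_add]; simp
  have h4 := mul_le_mul_of_nonneg_right h (exp_pos (-s * (t - t0))).le
  rw [mul_assoc, h3] at h4
  linarith

/-- Bootstrap barrier. -/
lemma barrier (f f' : ℝ → ℝ) (s c T : ℝ) (hs : 0 < s) (hcT : c < T)
    (hf : ∀ t ≥ 0, HasDerivAt f (f' t) t) (h0 : f 0 ≤ T)
    (hle : ∀ t ≥ 0, f t ≤ T → f' t ≤ s * (c - f t)) : ∀ t ≥ 0, f t ≤ T := by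
  intro t ht
  refine image_le_of_deriv_right_lt_deriv_boundary (f := f) (f' := f') (a := 0) (b := t)
    (B := fun _ => T) (B' := fun _ => 0) ?_ ?_ h0 ?_ ?_ ⟨ht, le_rfl⟩
  · exact fun x hx => (hf x hx.1).continuousAt.continuousWithinAt
  · exact fun x hx => (hf x hx.1).hasDerivWithinAt
  · exact fun x => hasDerivAt_const _ _
  · intro x hx he
    have := hle x hx.1 he.le
    rw [he] at this
    nlinarith


set_option maxHeartbeats 4000000

/-- exponential complete frequency synchronization under Assumption (A). -/
theorem exponential_frequency_synchronization
    (N : ℕ) (hN : 0 < N)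
    (a : Fin N → Fin N → ℝ)
    (hsym : ∀ i j, a i j = a j i)
    (hnn : ∀ i j, 0 ≤ a i j)
    (G : SimpleGraph (Fin N))
    (hadj : ∀ i j, G.Adj i j ↔ i ≠ j ∧ 0 < a i j)
    (hconn : G.Connected)
    (hEne : (Finset.filter (fun p : Fin N × Fin N => 0 < a p.1 p.2) Finset.univ).Nonempty)
    (r : ℕ)
    (hr : r = Finset.univ.sup (fun p : Fin N × Fin N => G.dist p.1 p.2))
    (Ec : ℕ)
    (hEc : Ec = (Finset.filter
      (fun p : Fin N × Fin N => ¬ 0 < a p.1 p.2) Finset.univ).card)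
    (al : ℝ)
    (hal : al = (Finset.filter (fun p : Fin N × Fin N => 0 < a p.1 p.2) Finset.univ).inf' hEne (fun p => a p.1 p.2))
    (au : ℝ)
    (hau : au = (Finset.filter (fun p : Fin N × Fin N => 0 < a p.1 p.2) Finset.univ).sup' hEne (fun p => a p.1 p.2))
    (m K α D0 : ℝ) (hm : 0 < m) (hK : 0 < K) (hα : 0 < α ∧ α < Real.pi / 2)
    (hD0 : 0 < D0 ∧ D0 < Real.pi)
    (Ω : Fin N → ℝ)
    (θ : Fin N → ℝ → ℝ)
    (hθ : ∀ i, ContDiff ℝ 3 (θ i))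
    (hODE : ∀ i, ∀ t ≥ (0 : ℝ),
      m * deriv (deriv (θ i)) t + deriv (θ i) t
        = Ω i + (K / (N : ℝ)) * ∑ l, a i l * Real.sin (θ l t - θ i t + α))
    (DΩ : ℝ) (hDΩ : DΩ = ∑ i, ∑ j, |Ω i - Ω j| ^ 2)
    (E1 : ℝ → ℝ)
    (hE1 : ∀ t, E1 t
      = 2 * m * (∑ i, ∑ j, (θ i t - θ j t) * (deriv (θ i) t - deriv (θ j) t))
        + (1 - m * Real.sqrt K) * (∑ i, ∑ j, (θ i t - θ j t) ^ 2)
        + 2 * m ^ 2 * (∑ i, ∑ j, (deriv (θ i) t - deriv (θ j) t) ^ 2))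
    (C1 : ℝ)
    (hC1 : C1
      = (3 * (1 + (Ec : ℝ) * (r : ℝ)) * D0 / (K * Real.sqrt K * al * Real.cos α * Real.sin D0)
          + 12 * m / Real.sqrt K) * DΩ
        + 12 * (N : ℝ) ^ 2 * Real.sqrt K * au ^ 2 * Real.sin α ^ 2
          * ((1 + (Ec : ℝ) * (r : ℝ)) * D0 / (al * Real.cos α * Real.sin D0) + 4 * m * K))
    (hinit : E1 0 < D0 ^ 2 / 8)
    (Dinf : ℝ) (hDinf : 0 < Dinf ∧ Dinf < Real.pi / 2) (hDinfD0 : Dinf < D0)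
    (hKbig : Real.sqrt K
      > ((1 + (r : ℝ) * (Ec : ℝ)) / (al * Real.cos α))
          * max (D0 / Real.sin D0) (1 / Real.cos Dinf))
    (hmK1 : m * Real.sqrt K < 1 / 8)
    (hmK2 : m * K
      < (al / (au ^ 2 * (1 + (r : ℝ) * (Ec : ℝ)) * Real.cos α))
          * min (Real.sin D0 / (36 * D0)) (Real.cos Dinf / 24))
    (hC1 : C1 < Dinf ^ 2 / 16)
    (hfrus : Real.sin α
      < al * Real.cos α * Real.cos Dinf
          / (12 * au * (1 + (r : ℝ) * (Ec : ℝ)) * Real.sin Dinf))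
    (hm1 : m < 1)
    (hKsin : K * Real.sin α < 1 / (8 * au * Real.sin Dinf))
    :
    ∃ C > (0 : ℝ), ∃ tstar ≥ (0 : ℝ), ∀ t ≥ tstar, ∀ i j,
      |deriv (θ i) t - deriv (θ j) t|
        ≤ C * Real.exp (-(Real.sqrt K / 2) * (t - tstar)) := by
  rename_i hC1def
  obtain ⟨hα0, hα1⟩ := hα
  obtain ⟨hI0, hI1⟩ := hDinf
  have hsinα : 0 < sin α := sin_pos_of_pos_of_lt_pi hα0 (by linarith [pi_pos])
  have hcosα : 0 < cos α := cos_pos_of_mem_Ioo ⟨by linarith [pi_pos], hα1⟩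
  have hsinD : 0 < sin D0 := sin_pos_of_pos_of_lt_pi hD0.1 hD0.2
  have hsinI : 0 < sin Dinf := sin_pos_of_pos_of_lt_pi hI0 (by linarith [pi_pos])
  have hcosI : 0 < cos Dinf := cos_pos_of_mem_Ioo ⟨by linarith [pi_pos], hI1⟩
  have hNr : (0 : ℝ) < N := by positivity
  have hal0 : 0 < al := by
    rw [hal, Finset.lt_inf'_iff]
    exact fun q hq => (Finset.mem_filter.1 hq).2
  have hale : ∀ i j, 0 < a i j → al ≤ a i j := by
    intro i j h
    rw [hal]
    exact Finset.inf'_le (f := fun p : Fin N × Fin N => a p.1 p.2)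
      (b := (i, j)) (Finset.mem_filter.2 ⟨Finset.mem_univ _, h⟩)
  have hleu' : ∀ i j, 0 < a i j → a i j ≤ au := by
    intro i j h
    rw [hau]
    exact Finset.le_sup' (f := fun p : Fin N × Fin N => a p.1 p.2)
      (b := (i, j)) (Finset.mem_filter.2 ⟨Finset.mem_univ _, h⟩)
  have hau0 : 0 < au := by
    obtain ⟨q, hq⟩ := hEne
    have := (Finset.mem_filter.1 hq).2
    linarith [hleu' _ _ this]
  have hleu : ∀ i j, a i j ≤ au := by
    intro i j
    rcases (hnn i j).eq_or_lt with h | h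
    · rw [← h]; exact hau0.le
    · exact hleu' i j h
  set s := Real.sqrt K with hsdef
  have hs0 : 0 < s := Real.sqrt_pos.2 hK
  have hKs : K = s * s := (Real.mul_self_sqrt hK.le).symm
  set L : ℝ := 1 + (r : ℝ) * (Ec : ℝ) with hL
  have hL' : 1 + (Ec : ℝ) * (r : ℝ) = L := by rw [hL]; ring
  have hL0 : 0 < L := by positivity
  -- rates
  set κ1 : ℝ := K * cos α * (al * (sin D0 / D0)) / L with hκ1
  set κ2 : ℝ := K * cos α * (al * cos Dinf) / L with hκ2
  have hD00 := hD0.1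
  have hκ10 : 0 < κ1 := by positivity
  have hκ20 : 0 < κ2 := by positivity
  have hsκ1 : s ≤ κ1 := by
    have h1 : L / (al * cos α) * (D0 / sin D0) < s :=
      lt_of_le_of_lt (by gcongr; exact le_max_left _ _) hKbig
    have h2 : L / (al * cos α) * (D0 / sin D0) * κ1 = s * s := by
      rw [hκ1, hKs]; field_simp
    by_contra hcon
    push Not at hcon
    nlinarith
  have hsκ2 : s ≤ κ2 := by
    have h1 : L / (al * cos α) * (1 / cos Dinf) < s :=
      lt_of_le_of_lt (by gcongr; exact le_max_right _ _) hKbig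
    have h2 : L / (al * cos α) * (1 / cos Dinf) * κ2 = s * s := by
      rw [hκ2, hKs]; field_simp
    by_contra hcon
    push Not at hcon
    nlinarith
  have hβ1 : m * ((K * cos α) ^ 2 * au ^ 2) ≤ κ1 / 36 := by
    have h1 : m * K ≤ al / (au ^ 2 * L * cos α) * (sin D0 / (36 * D0)) :=
      hmK2.le.trans (by gcongr; exact min_le_left _ _)
    calc m * ((K * cos α) ^ 2 * au ^ 2) = m * K * (K * cos α ^ 2 * au ^ 2) := by ring
      _ ≤ al / (au ^ 2 * L * cos α) * (sin D0 / (36 * D0)) * (K * cos α ^ 2 * au ^ 2) := by gcongr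
      _ = κ1 / 36 := by rw [hκ1]; field_simp
  have hβ2 : m * ((K * cos α) ^ 2 * au ^ 2) ≤ κ2 / 24 := by
    have h1 : m * K ≤ al / (au ^ 2 * L * cos α) * (cos Dinf / 24) :=
      hmK2.le.trans (by gcongr; exact min_le_right _ _)
    calc m * ((K * cos α) ^ 2 * au ^ 2) = m * K * (K * cos α ^ 2 * au ^ 2) := by ring
      _ ≤ al / (au ^ 2 * L * cos α) * (cos Dinf / 24) * (K * cos α ^ 2 * au ^ 2) := by gcongr
      _ = κ2 / 24 := by rw [hκ2]; field_simp
  set b : ℝ := K * sin α * (au * sin Dinf) with hb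
  have hb0 : 0 ≤ b := by positivity
  have hb2 : b ≤ 1 / 8 := by
    calc b ≤ 1 / (8 * au * sin Dinf) * (au * sin Dinf) := by rw [hb]; gcongr
      _ = 1 / 8 := by field_simp
  have hb1 : b ≤ κ2 / 12 := by
    calc b = K * (au * sin Dinf) * sin α := by rw [hb]; ring
      _ ≤ K * (au * sin Dinf) * (al * cos α * cos Dinf / (12 * au * L * sin Dinf)) := by gcongr
      _ = κ2 / 12 := by rw [hκ2]; field_simp
  -- regularity
  have hd1 : ∀ i t, HasDerivAt (θ i) (deriv (θ i) t) t := fun i t =>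
    ((hθ i).differentiable (by norm_num) t).hasDerivAt
  have hC2 : ∀ i, ContDiff ℝ 2 (deriv (θ i)) := fun i =>
    ((contDiff_succ_iff_deriv (n := 2)).1 (by rw [show (2 : WithTop ℕ∞) + 1 = 3 by norm_num]; exact hθ i)).2.2
  have hd2 : ∀ i t, HasDerivAt (deriv (θ i)) (deriv (deriv (θ i)) t) t := fun i t =>
    ((hC2 i).differentiable (by norm_num) t).hasDerivAt
  have hC3 : ∀ i, ContDiff ℝ 1 (deriv (deriv (θ i))) := fun i =>
    ((contDiff_succ_iff_deriv (n := 1)).1 (by rw [show (1 : WithTop ℕ∞) + 1 = 2 by norm_num]; exact hC2 i)).2.2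
  have hd3 : ∀ i t, HasDerivAt (deriv (deriv (θ i))) (deriv (deriv (deriv (θ i))) t) t := fun i t =>
    ((hC3 i).differentiable (by norm_num) t).hasDerivAt
  -- the two energies
  have hE1' : ∀ t, E1 t = EN m s (fun i => θ i t) (fun i => deriv (θ i) t) := by
    intro t
    rw [hE1]
    unfold EN BF
    simp only [sq]
  have hpair : ∀ t D, 0 < D → E1 t ≤ D ^ 2 / 8 → ∀ i j, |θ i t - θ j t| ≤ D := by
    intro t D hD hE i j
    have h1 := EN_lower m s (fun i => θ i t) (fun i => deriv (θ i) t) hm hmK1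
    have h2 := BF_pair (fun i => θ i t) i j
    rw [← hE1'] at h1
    refine abs_le_of_sq_le_sq ?_ hD.le
    nlinarith [sq_nonneg D]
  -- phase one
  set BCb : ℝ := 4 * (N : ℝ) ^ 2 * ((K * sin α) ^ 2 * au ^ 2) with hBCb
  have hsC1 : 3 / κ1 * DΩ + 12 * m * DΩ + (3 / κ1 * BCb + 12 * m * BCb) = s * C1 := by
    rw [hC1def, hL', hBCb, hκ1, hKs]
    field_simp
    ring
  have hDΩ' : BF Ω Ω = DΩ := by
    rw [hDΩ]
    exact Finset.sum_congr rfl fun i _ => Finset.sum_congr rfl fun j _ => by rw [sq_abs, sq]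
  set e' : ℝ → ℝ := fun t => deriv E1 t with he'
  have hEd : ∀ t ≥ 0, HasDerivAt E1 (e' t) t ∧ (E1 t ≤ D0 ^ 2 / 8 → e' t ≤ s * (C1 - E1 t)) := by
    intro t ht
    have hd := EN_hasDeriv m s (fun t i => θ i t) (fun t i => deriv (θ i) t)
      (fun i => deriv (deriv (θ i)) t)
      (fun i => (Ω i + K * cos α / N * ∑ l, a i l * sin (θ l t - θ i t))
        + K * sin α / N * ∑ l, a i l * cos (θ l t - θ i t)) t (fun i => hd1 i t) (fun i => hd2 i t)
      (by
        intro i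
        rw [hODE i t ht]
        simp only [sin_add, mul_add, Finset.sum_add_distrib, Finset.mul_sum]
        rw [add_assoc]
        congr 1
        congr 1 <;> exact Finset.sum_congr rfl fun l _ => by ring)
    rw [← funext hE1'] at hd
    have hee : e' t = _ := hd.deriv
    refine ⟨by rw [hee]; exact hd, fun hE => ?_⟩
    have hx := hpair t D0 hD00 hE
    rw [hee, ← hE1']
    simp only [BF_add]
    have hY := sin_mul_ge D0
    have hPS := coupling_coercive hN a G hadj hconn r hr Ec hEc (fun i => θ i t)
      (fun i l => a i l * sin (θ l t - θ i t)) (K * cos α) (al * (sin D0 / D0))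
      (by positivity) (by positivity)
      (by
        intro i l
        rw [hsym i l, ← neg_sub (θ i t) (θ l t), sin_neg]; ring)
      (by
        intro i l
        have h1 := hY (θ l t - θ i t) hD0 (hx l i)
        have h2 : 0 ≤ sin D0 / D0 * (θ l t - θ i t) ^ 2 := by positivity
        have h3 := mul_nonneg (hnn i l) (h2.trans h1)
        linarith)
      (by
        intro i l hil
        have h1 := hY (θ l t - θ i t) hD0 (hx l i)
        have h2 : 0 ≤ sin D0 / D0 * (θ l t - θ i t) ^ 2 := by positivity
        calc _ = al * (sin D0 / D0 * (θ l t - θ i t) ^ 2) := by ring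
          _ ≤ a i l * ((θ l t - θ i t) * sin (θ l t - θ i t)) :=
            mul_le_mul (hale i l hil) h1 h2 (hnn i l)
          _ = _ := by ring)
    have hBS := BF_coupling_sq hN (fun i => θ i t)
      (fun i l => a i l * sin (θ l t - θ i t)) (K * cos α) au
      (by
        intro i l
        rw [mul_pow]
        have h1 : sin (θ l t - θ i t) ^ 2 ≤ (θ l t - θ i t) ^ 2 :=
          sq_le_sq.2 (abs_sin_le_abs)
        have h2 := hleu i l
        have h3 := hnn i l
        gcongr)
    have hBC := BF_bounded_sq hN (fun i l => a i l * cos (θ l t - θ i t)) (K * sin α) au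
      (by positivity)
      (by
        intro i l
        rw [abs_mul, abs_of_nonneg (hnn i l)]
        calc a i l * |cos (θ l t - θ i t)| ≤ au * 1 := by
              have h2 := hleu i l
              have h3 := abs_cos_le_one (θ l t - θ i t)
              gcongr
          _ = au := mul_one _)
    rw [← hBCb] at hBC
    have y1 := BF_young (fun i => θ i t) Ω (κ1 / 3) (by positivity)
    have y2 := BF_young (fun i => θ i t)
      (fun i => K * sin α / N * ∑ l, a i l * cos (θ l t - θ i t)) (κ1 / 3) (by positivity)
    have y3 := BF_young (fun i => deriv (θ i) t) Ω (1 / 6) (by norm_num)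
    have y4 := BF_young (fun i => deriv (θ i) t)
      (fun i => K * sin α / N * ∑ l, a i l * cos (θ l t - θ i t)) (1 / 6) (by norm_num)
    have y5 := BF_young (fun i => deriv (θ i) t)
      (fun i => K * cos α / N * ∑ l, a i l * sin (θ l t - θ i t)) (1 / 2) (by norm_num)
    have hfin := phase1_scalar m s κ1 _ _ _ _ _ _ _ _ _ _ _ _ hm hs0 hsκ1 hmK1
      (BF_self_nonneg (fun i => θ i t)) (BF_self_nonneg (fun i => deriv (θ i) t)) hPS y1 y2 y3 y4 y5
      hBS hβ1
    rw [hDΩ'] at hfin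
    have hm3 : 3 / κ1 * BF (fun i => K * sin α / N * ∑ l, a i l * cos (θ l t - θ i t))
      (fun i => K * sin α / N * ∑ l, a i l * cos (θ l t - θ i t)) ≤ 3 / κ1 * BCb := by gcongr
    have hm4 : 12 * m * BF (fun i => K * sin α / N * ∑ l, a i l * cos (θ l t - θ i t))
      (fun i => K * sin α / N * ∑ l, a i l * cos (θ l t - θ i t)) ≤ 12 * m * BCb := by gcongr
    linarith
  have hDD : Dinf ^ 2 < D0 ^ 2 := by gcongr
  have hC1T : C1 < D0 ^ 2 / 8 := by nlinarith [sq_nonneg Dinf]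
  have hbar := barrier E1 e' s C1 (D0 ^ 2 / 8) hs0 hC1T (fun t ht => (hEd t ht).1) hinit.le
    (fun t ht => (hEd t ht).2)
  have hgr := gron E1 e' s C1 0 (fun t ht => (hEd t ht).1)
    (fun t ht => (hEd t ht).2 (hbar t ht))
  have hlim : Filter.Tendsto (fun t => C1 + (E1 0 - C1) * exp (-s * (t - 0))) Filter.atTop
      (nhds (C1 + (E1 0 - C1) * 0)) := by
    refine Filter.Tendsto.const_add _ (Filter.Tendsto.const_mul _ ?_)
    refine tendsto_exp_atBot.comp ?_
    simp only [sub_zero]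
    exact Filter.tendsto_id.const_mul_atTop_of_neg (by linarith)
  have hev : ∀ᶠ t in Filter.atTop, C1 + (E1 0 - C1) * exp (-s * (t - 0)) < Dinf ^ 2 / 8 := by
    refine hlim.eventually (gt_mem_nhds ?_)
    nlinarith [sq_pos_of_pos hI0]
  obtain ⟨t1, ht1⟩ := Filter.eventually_atTop.1 hev
  set ts := max t1 1 with hts
  have hts1 : 1 ≤ ts := le_max_right _ _
  have hxI : ∀ t ≥ ts, ∀ i j, |θ i t - θ j t| ≤ Dinf := by
    intro t ht
    refine hpair t Dinf hI0 ?_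
    exact (hgr t (by linarith)).trans (ht1 t ((le_max_left _ _).trans ht)).le
  -- phase two
  set E2 : ℝ → ℝ := fun t => EN m s (fun i => deriv (θ i) t) (fun i => deriv (deriv (θ i)) t)
    with hE2
  have hODE2 : ∀ i, ∀ t ≥ ts, m * deriv (deriv (deriv (θ i))) t + deriv (deriv (θ i)) t
      = (K / (N : ℝ)) * ∑ l, a i l * (cos (θ l t - θ i t + α) * (deriv (θ l) t - deriv (θ i) t)) := by
    intro i t ht
    have h1 : HasDerivAt (fun t => m * deriv (deriv (θ i)) t + deriv (θ i) t)
        (m * deriv (deriv (deriv (θ i))) t + deriv (deriv (θ i)) t) t :=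
      ((hd3 i t).const_mul m).add (hd2 i t)
    have h2 : HasDerivAt (fun t => Ω i + (K / (N : ℝ)) * ∑ l, a i l * sin (θ l t - θ i t + α))
        ((K / (N : ℝ)) * ∑ l, a i l * (cos (θ l t - θ i t + α) * (deriv (θ l) t - deriv (θ i) t)))
        t := by
      refine HasDerivAt.const_add _ (HasDerivAt.const_mul _ (HasDerivAt.fun_sum fun l _ => ?_))
      exact ((((hd1 l t).sub (hd1 i t)).add_const α).sin).const_mul _
    refine h1.unique (h2.congr_of_eventuallyEq ?_)
    filter_upwards [lt_mem_nhds (show 0 < t by linarith)] with u hu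
    exact hODE i u hu.le
  have hE2d : ∀ t ≥ ts, HasDerivAt E2 (deriv E2 t) t ∧ deriv E2 t ≤ s * (0 - E2 t) := by
    intro t ht
    have hd := EN_hasDeriv m s (fun t i => deriv (θ i) t) (fun t i => deriv (deriv (θ i)) t)
      (fun i => deriv (deriv (deriv (θ i))) t)
      (fun i => K * cos α / N * ∑ l, a i l * cos (θ l t - θ i t) * (deriv (θ l) t - deriv (θ i) t)
        + K * sin α / N * ∑ l, -(a i l * sin (θ l t - θ i t) * (deriv (θ l) t - deriv (θ i) t))) t
      (fun i => hd2 i t) (fun i => hd3 i t)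
      (by
        intro i
        rw [hODE2 i t ht]
        simp only [Finset.mul_sum]
        rw [← Finset.sum_add_distrib]
        exact Finset.sum_congr rfl fun l _ => by rw [cos_add]; ring)
    have hee : deriv E2 t = _ := hd.deriv
    refine ⟨by rw [hee]; exact hd, ?_⟩
    have hx := hxI t ht
    rw [hee]
    simp only [BF_add]
    have hcosx : ∀ i l, cos Dinf ≤ cos (θ l t - θ i t) := by
      intro i l
      rw [← cos_abs (θ l t - θ i t)]
      exact cos_le_cos_of_nonneg_of_le_pi (abs_nonneg _) (by linarith [pi_pos]) (hx l i)
    have hsinx : ∀ i l, sin (θ l t - θ i t) ^ 2 ≤ sin Dinf ^ 2 := by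
      intro i l
      have h1 := hcosx i l
      have h2 := sin_sq_add_cos_sq Dinf
      have h3 := sin_sq_add_cos_sq (θ l t - θ i t)
      nlinarith
    have hPP := coupling_coercive hN a G hadj hconn r hr Ec hEc (fun i => deriv (θ i) t)
      (fun i l => a i l * cos (θ l t - θ i t) * (deriv (θ l) t - deriv (θ i) t))
      (K * cos α) (al * cos Dinf)
      (by positivity) (by positivity)
      (by
        intro i l
        rw [hsym i l, ← neg_sub (θ i t) (θ l t), cos_neg]; ring)
      (by
        intro i l
        have h1 := hcosI.le.trans (hcosx i l)
        have h3 := mul_nonneg (mul_nonneg (hnn i l) h1) (sq_nonneg (deriv (θ l) t - deriv (θ i) t))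
        linarith)
      (by
        intro i l hil
        have h1 : al * cos Dinf ≤ a i l * cos (θ l t - θ i t) :=
          mul_le_mul (hale i l hil) (hcosx i l) hcosI.le (hnn i l)
        calc _ ≤ a i l * cos (θ l t - θ i t) * (deriv (θ l) t - deriv (θ i) t) ^ 2 := by gcongr
          _ = _ := by ring)
    have hBP := BF_coupling_sq hN (fun i => deriv (θ i) t)
      (fun i l => a i l * cos (θ l t - θ i t) * (deriv (θ l) t - deriv (θ i) t)) (K * cos α) au
      (by
        intro i l
        rw [mul_pow, mul_pow]
        have h1 := cos_sq_le_one (θ l t - θ i t)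
        have h2 := hleu i l
        have h3 := hnn i l
        calc _ ≤ au ^ 2 * 1 * (deriv (θ l) t - deriv (θ i) t) ^ 2 := by gcongr
          _ = _ := by ring)
    have hBQ := BF_coupling_sq hN (fun i => deriv (θ i) t)
      (fun i l => -(a i l * sin (θ l t - θ i t) * (deriv (θ l) t - deriv (θ i) t))) (K * sin α)
      (au * sin Dinf)
      (by
        intro i l
        rw [neg_sq, mul_pow, mul_pow, mul_pow]
        have h1 := hsinx i l
        have h2 := hleu i l
        have h3 := hnn i l
        gcongr)
    rw [← mul_pow (K * sin α), ← hb] at hBQ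
    have y1 := BF_young (fun i => deriv (θ i) t)
      (fun i => K * sin α / N *
        ∑ l, -(a i l * sin (θ l t - θ i t) * (deriv (θ l) t - deriv (θ i) t)))
      (κ2 / 6) (by positivity)
    have y2 := BF_young (fun i => deriv (deriv (θ i)) t)
      (fun i => K * cos α / N *
        ∑ l, a i l * cos (θ l t - θ i t) * (deriv (θ l) t - deriv (θ i) t)) (1 / 2) (by norm_num)
    have y3 := BF_young (fun i => deriv (deriv (θ i)) t)
      (fun i => K * sin α / N *
        ∑ l, -(a i l * sin (θ l t - θ i t) * (deriv (θ l) t - deriv (θ i) t)))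
      (3 / 8) (by norm_num)
    have hfin := phase2_scalar m s κ2 _ _ _ _ _ _ _ _ _ b hm hm1 hs0 hsκ2 hmK1
      (BF_self_nonneg (fun i => deriv (θ i) t)) (BF_self_nonneg (fun i => deriv (deriv (θ i)) t))
      hPP y1 y2 y3 hBP hβ2 hBQ hb0 hb1 hb2
    simp only [hE2]
    linarith
  have hg2 := gron E2 (deriv E2) s 0 ts (fun t ht => (hE2d t ht).1) (fun t ht => (hE2d t ht).2)
  have hE2low : ∀ t i j, 3 / 8 * (deriv (θ i) t - deriv (θ j) t) ^ 2 ≤ E2 t := by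
    intro t i j
    have h1 := EN_lower m s (fun i => deriv (θ i) t) (fun i => deriv (deriv (θ i)) t) hm hmK1
    have h2 := BF_pair (fun i => deriv (θ i) t) i j
    simp only [hE2]
    linarith
  have hE20 : 0 ≤ E2 ts := le_trans (by positivity) (hE2low ts ⟨0, hN⟩ ⟨0, hN⟩)
  refine ⟨Real.sqrt (8 / 3 * E2 ts) + 1, by positivity, ts, by linarith, ?_⟩
  intro t ht i j
  have h1 := hg2 t ht
  have h2 := hE2low t i j
  have h3 : exp (-s * (t - ts)) = exp (-(s / 2) * (t - ts)) ^ 2 := by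
    rw [← exp_nat_mul]; congr 1; push_cast; ring
  have h4 := exp_pos (-(s / 2) * (t - ts))
  have h5 : Real.sqrt (8 / 3 * E2 ts) ^ 2 = 8 / 3 * E2 ts := Real.sq_sqrt (by positivity)
  have h6 : |deriv (θ i) t - deriv (θ j) t|
      ≤ Real.sqrt (8 / 3 * E2 ts) * exp (-(s / 2) * (t - ts)) := by
    refine abs_le_of_sq_le_sq ?_ (by positivity)
    rw [mul_pow, h5, ← h3]
    linarith
  linarith
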